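/- Let A ∈ ℝ^{n×n}, B ∈ ℝ^{n×m}, let R ∈ ℝ^{m×m} be symmetric positive definite, and let P ∈ ℝ^{n×n} be symmetric positive definite with P − Aᵀ P A positive definite. Then there exist ε > 0 and ρ > 0 such that for all x̃ ∈ ℝⁿ and ũ ∈ ℝᵐ: ũᵀ R ũ + ε x̃ᵀ P x̃ − ε (A x̃ + B ũ)ᵀ P (A x̃ + B ũ) ≥ ρ ‖x̃‖². -/

import Mathlib

open Matrix

/-- Matrix-vector multiplication on Euclidean space. -/
noncomputable def mulVecE {n m : ℕ} (M : Matrix (Fin n) (Fin m) ℝ)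
    (x : EuclideanSpace ℝ (Fin m)) : EuclideanSpace ℝ (Fin n) :=
  WithLp.toLp 2 (fun i => ∑ j, M i j * x j)

lemma sum_eq_dot_aux {n m : ℕ} (M : Matrix (Fin n) (Fin m) ℝ) (x : Fin n → ℝ) (y : Fin m → ℝ) :
    ∑ i, ∑ j, x i * M i j * y j = x ⬝ᵥ M *ᵥ y := by
  simp [dotProduct, mulVec, Finset.mul_sum, mul_assoc]

lemma bilin_bound_aux {n m : ℕ} (M : Matrix (Fin n) (Fin m) ℝ) :
    ∃ K : ℝ, 0 ≤ K ∧ ∀ (x : EuclideanSpace ℝ (Fin n)) (y : EuclideanSpace ℝ (Fin m)),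
      x.ofLp ⬝ᵥ M *ᵥ y.ofLp ≤ K * (‖x‖ * ‖y‖) := by
  refine ⟨∑ i, ∑ j, |M i j|, by positivity, fun x y => ?_⟩
  rw [← sum_eq_dot_aux, Finset.sum_mul]
  refine Finset.sum_le_sum fun i _ => ?_
  rw [Finset.sum_mul]
  refine Finset.sum_le_sum fun j _ => ?_
  have hx : |x i| ≤ ‖x‖ := by simpa using PiLp.norm_apply_le x i
  have hy : |y j| ≤ ‖y‖ := by simpa using PiLp.norm_apply_le y j
  calc x i * M i j * y j ≤ |x i * M i j * y j| := le_abs_self _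
    _ = |M i j| * (|x i| * |y j|) := by rw [abs_mul, abs_mul]; ring
    _ ≤ _ := by gcongr

lemma posDef_bound_aux {n : ℕ} (M : Matrix (Fin n) (Fin n) ℝ) (hM : M.PosDef) :
    ∃ c : ℝ, 0 < c ∧ ∀ x : EuclideanSpace ℝ (Fin n),
      c * ‖x‖ ^ 2 ≤ x.ofLp ⬝ᵥ M *ᵥ x.ofLp := by
  have hpos : ∀ x : EuclideanSpace ℝ (Fin n), x ≠ 0 → 0 < x.ofLp ⬝ᵥ M *ᵥ x.ofLp := by
    intro x hx
    have : x.ofLp ≠ 0 := by simpa using hx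
    simpa using hM.dotProduct_mulVec_pos this
  have hcont : Continuous fun x : EuclideanSpace ℝ (Fin n) => x.ofLp ⬝ᵥ M *ᵥ x.ofLp := by
    simp only [← sum_eq_dot_aux]
    fun_prop
  rcases (Metric.sphere (0 : EuclideanSpace ℝ (Fin n)) 1).eq_empty_or_nonempty with h | h
  · refine ⟨1, one_pos, fun x => ?_⟩
    by_cases hx : x = 0
    · simp [hx]
    · exfalso
      have : ‖x‖⁻¹ • x ∈ Metric.sphere (0 : EuclideanSpace ℝ (Fin n)) 1 := by
        simp [norm_smul, hx]
      simp [h] at this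
  · obtain ⟨z, hz, hmin⟩ := (isCompact_sphere _ _).exists_isMinOn h hcont.continuousOn
    refine ⟨_, hpos z ?_, fun x => ?_⟩
    · rintro rfl
      simp at hz
    · by_cases hx : x = 0
      · simp [hx]
      have hm : ‖x‖⁻¹ • x ∈ Metric.sphere (0 : EuclideanSpace ℝ (Fin n)) 1 := by
        simp [norm_smul, hx]
      have h1 := isMinOn_iff.1 hmin _ hm
      simp only [WithLp.ofLp_smul, mulVec_smul, dotProduct_smul, smul_dotProduct,
        smul_eq_mul] at h1
      have hn : 0 < ‖x‖ := norm_pos_iff.2 hx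
      calc _ ≤ (‖x‖⁻¹ * (‖x‖⁻¹ * (x.ofLp ⬝ᵥ M *ᵥ x.ofLp))) * ‖x‖ ^ 2 := by gcongr
        _ = _ := by field_simp

/-- If `R` and `P` are symmetric positive definite and `P - Aᵀ P A` is
positive definite, then there exist `ε > 0` and `ρ > 0` such that
`ũᵀ R ũ + ε x̃ᵀ P x̃ - ε (A x̃ + B ũ)ᵀ P (A x̃ + B ũ) ≥ ρ ‖x̃‖²` for all `x̃, ũ`. -/
theorem strict_dissipation_inequality {n m : ℕ}
    (A : Matrix (Fin n) (Fin n) ℝ) (B : Matrix (Fin n) (Fin m) ℝ)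
    (R : Matrix (Fin m) (Fin m) ℝ) (hR : R.PosDef)
    (P : Matrix (Fin n) (Fin n) ℝ) (hP : P.PosDef)
    (hPA : (P - Aᵀ * P * A).PosDef) :
    ∃ ε > (0 : ℝ), ∃ ρ > (0 : ℝ),
      ∀ (x : EuclideanSpace ℝ (Fin n)) (u : EuclideanSpace ℝ (Fin m)),
        ρ * ‖x‖ ^ 2 ≤
          (∑ i, ∑ j, u i * R i j * u j) + ε * (∑ i, ∑ j, x i * P i j * x j) -
            ε * ∑ i, ∑ j,
              (mulVecE A x + mulVecE B u) i * P i j * (mulVecE A x + mulVecE B u) j := by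
  obtain ⟨r, hr, hr'⟩ := posDef_bound_aux R hR
  obtain ⟨q, hq, hq'⟩ := posDef_bound_aux _ hPA
  obtain ⟨K, hK, hK'⟩ := bilin_bound_aux (Aᵀ * P * B)
  obtain ⟨J, hJ, hJ'⟩ := bilin_bound_aux (Bᵀ * P * A)
  obtain ⟨L, hL, hL'⟩ := bilin_bound_aux (Bᵀ * P * B)
  have hD : 0 < L + (K + J) ^ 2 / (2 * q) + 1 := by positivity
  refine ⟨r / (L + (K + J) ^ 2 / (2 * q) + 1), by positivity,
    r / (L + (K + J) ^ 2 / (2 * q) + 1) * (q / 2), by positivity, fun x u => ?_⟩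
  have hεD : r / (L + (K + J) ^ 2 / (2 * q) + 1) * (L + (K + J) ^ 2 / (2 * q) + 1) = r := by
    field_simp
  have hε : 0 < r / (L + (K + J) ^ 2 / (2 * q) + 1) := by positivity
  set ε := r / (L + (K + J) ^ 2 / (2 * q) + 1)
  have e : (mulVecE A x + mulVecE B u).ofLp = A *ᵥ x.ofLp + B *ᵥ u.ofLp := by
    ext i
    simp [mulVecE, mulVec, dotProduct]
  rw [sum_eq_dot_aux, sum_eq_dot_aux, sum_eq_dot_aux, e]
  have key : ∀ {a b : ℕ} (C : Matrix (Fin n) (Fin a) ℝ) (D : Matrix (Fin n) (Fin b) ℝ)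
      (v : Fin a → ℝ) (w : Fin b → ℝ),
      (C *ᵥ v) ⬝ᵥ P *ᵥ (D *ᵥ w) = v ⬝ᵥ (Cᵀ * P * D) *ᵥ w := by
    intro a b C D v w
    rw [← mulVec_mulVec, ← mulVec_mulVec, dotProduct_mulVec v, vecMul_transpose]
  have h1 := hr' u
  have h2 := hq' x
  have h3 := hK' x u
  have h4 := hJ' u x
  have h5 := hL' u u
  rw [sub_mulVec, dotProduct_sub] at h2
  simp only [mulVec_add, dotProduct_add, add_dotProduct, key]
  have h6 : (K + J) * (‖x‖ * ‖u‖) ≤ q / 2 * ‖x‖ ^ 2 + (K + J) ^ 2 / (2 * q) * ‖u‖ ^ 2 := by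
    have : q / 2 * ‖x‖ ^ 2 + (K + J) ^ 2 / (2 * q) * ‖u‖ ^ 2 - (K + J) * (‖x‖ * ‖u‖)
        = (q * ‖x‖ - (K + J) * ‖u‖) ^ 2 / (2 * q) := by
      field_simp
      ring
    have h7 : 0 ≤ (q * ‖x‖ - (K + J) * ‖u‖) ^ 2 / (2 * q) := by positivity
    linarith
  set D := (K + J) ^ 2 / (2 * q)
  have h8 : q / 2 * ‖x‖ ^ 2 - (L + D + 1) * ‖u‖ ^ 2 ≤
      x.ofLp ⬝ᵥ P *ᵥ x.ofLp - (x.ofLp ⬝ᵥ (Aᵀ * P * A) *ᵥ x.ofLp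
        + u.ofLp ⬝ᵥ (Bᵀ * P * A) *ᵥ x.ofLp + (x.ofLp ⬝ᵥ (Aᵀ * P * B) *ᵥ u.ofLp
        + u.ofLp ⬝ᵥ (Bᵀ * P * B) *ᵥ u.ofLp)) := by
    nlinarith [sq_nonneg ‖u‖]
  have h9 := mul_le_mul_of_nonneg_left h8 hε.le
  have h10 : ε * ((L + D + 1) * ‖u‖ ^ 2) = r * ‖u‖ ^ 2 := by rw [← mul_assoc, hεD]
  linarith
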